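/- arXiv:1709.07907 — 2 statements merged into one kernel-verified Lean document; each statement's English description precedes it below -/
import Mathlib

section
/- Let X be a finite simple graph on n vertices whose adjacency matrix A has n distinct eigenvalues, and let z_1,…,z_n be an orthonormal eigenbasis of A with Az_i = λ_i z_i. For each i, let μ_i and ν_i be the two (real, distinct) roots of t² − λ_i t − 1 = 0. Then the 2n vectors (1/√(μ_i²+1))·(μ_i z_i ; z_i) and (1/√(ν_i²+1))·(ν_i z_i ; z_i), for i = 1,…,n, form an orthonormal basis of ℝ^{2n} consisting of eigenvectors of B = [[A, I],[I, 0]], with eigenvalues μ_i and ν_i respectively. -/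
open scoped Matrix

/-- Given an orthonormal eigenbasis `z i` of `A` (with `n` distinct
eigenvalues `λ i`), and `μ i, ν i` the two real roots of `t² − λ i · t − 1 = 0`, the `2n`
vectors `(μ i • z i ; z i)/√(μ i² + 1)` and `(ν i • z i ; z i)/√(ν i² + 1)` form an
orthonormal basis of `ℝ^{2n}` of eigenvectors of `B = [[A, I], [I, 0]]`, with eigenvalues
`μ i` and `ν i` respectively. -/
theorem orthonormal_eigenbasis_rootedProduct {V : Type*} [Fintype V] [DecidableEq V]
    (G : SimpleGraph V) [DecidableRel G.Adj]
    (A : Matrix V V ℝ) (hA : A = G.adjMatrix ℝ)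
    (lam : V → ℝ) (hlam : Function.Injective lam)
    (z : V → V → ℝ)
    (honb : ∀ i j, z i ⬝ᵥ z j = if i = j then 1 else 0)
    (heig : ∀ i, A *ᵥ z i = lam i • z i)
    (μ ν : V → ℝ)
    (hμ : ∀ i, μ i ^ 2 - lam i * μ i - 1 = 0)
    (hν : ∀ i, ν i ^ 2 - lam i * ν i - 1 = 0)
    (hμν : ∀ i, μ i ≠ ν i)
    (B : Matrix (V ⊕ V) (V ⊕ V) ℝ) (hB : B = Matrix.fromBlocks A 1 1 0) :
    let w : V ⊕ V → (V ⊕ V → ℝ) :=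
      Sum.elim
        (fun i => (Real.sqrt (μ i ^ 2 + 1))⁻¹ • Sum.elim (μ i • z i) (z i))
        (fun i => (Real.sqrt (ν i ^ 2 + 1))⁻¹ • Sum.elim (ν i • z i) (z i))
    (∀ p q, w p ⬝ᵥ w q = if p = q then 1 else 0) ∧
      (∀ i, B *ᵥ w (Sum.inl i) = μ i • w (Sum.inl i)) ∧
      (∀ i, B *ᵥ w (Sum.inr i) = ν i • w (Sum.inr i)) ∧
      Submodule.span ℝ (Set.range w) = ⊤ := by
  have hprod : ∀ i, μ i * ν i = -1 := by
    intro i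
    have h1 := hμ i
    have h2 := hν i
    have h3 : (μ i - ν i) * (μ i + ν i - lam i) = 0 := by linear_combination h1 - h2
    rcases mul_eq_zero.mp h3 with h | h
    · exact absurd (sub_eq_zero.mp h) (hμν i)
    · linear_combination μ i * h - h1
  have hdot : ∀ (a b c d : ℝ) (i j : V),
      (a • Sum.elim (b • z i) (z i) : V ⊕ V → ℝ) ⬝ᵥ (c • Sum.elim (d • z j) (z j)) =
        a * c * (b * d + 1) * (if i = j then 1 else 0) := by
    intro a b c d i j
    rw [smul_dotProduct, dotProduct_smul, sumElim_dotProduct_sumElim,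
      smul_dotProduct, dotProduct_smul, honb]
    simp only [smul_eq_mul]
    ring
  have hnorm : ∀ t : ℝ, (Real.sqrt (t ^ 2 + 1))⁻¹ * (Real.sqrt (t ^ 2 + 1))⁻¹ * (t * t + 1) = 1 := by
    intro t
    have hp : 0 < t ^ 2 + 1 := by positivity
    have hs := Real.mul_self_sqrt hp.le
    rw [← mul_inv, hs, ← sq]
    exact inv_mul_cancel₀ hp.ne'
  have hev : ∀ (a t : ℝ) (i : V), t ^ 2 - lam i * t - 1 = 0 →
      B *ᵥ (a • Sum.elim (t • z i) (z i) : V ⊕ V → ℝ) = t • (a • Sum.elim (t • z i) (z i)) := by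
    intro a t i ht
    rw [hB, Matrix.mulVec_smul, smul_comm t a, Matrix.fromBlocks_mulVec]
    congr 1
    ext p
    rcases p with p | p
    · simp [Matrix.mulVec_smul, heig]
      linear_combination (-(z i p)) * ht
    · simp
  intro w
  have hw : ∀ p q, w p ⬝ᵥ w q = if p = q then 1 else 0 := by
    rintro (i | i) (j | j)
    · simp only [w, Sum.elim_inl, hdot, Sum.inl.injEq]
      by_cases h : i = j
      · subst h; simp only [hnorm, if_true, mul_one]
      · simp [h]
    · simp only [w, Sum.elim_inl, Sum.elim_inr, hdot]
      by_cases h : i = j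
      · subst h; simp [hprod]
      · simp [h]
    · simp only [w, Sum.elim_inl, Sum.elim_inr, hdot]
      by_cases h : i = j
      · subst h; simp [mul_comm (ν i), hprod]
      · simp [h]
    · simp only [w, Sum.elim_inr, hdot, Sum.inr.injEq]
      by_cases h : i = j
      · subst h; simp only [hnorm, if_true, mul_one]
      · simp [h]
  refine ⟨hw, fun i => hev _ _ i (hμ i), fun i => hev _ _ i (hν i), ?_⟩
  have hli : LinearIndependent ℝ w := by
    rw [Fintype.linearIndependent_iff]
    intro g hg j
    have h := congrArg (fun v => v ⬝ᵥ w j) hg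
    simpa [sum_dotProduct, smul_dotProduct, hw, -Fintype.sum_sum_type] using h
  exact hli.span_eq_top_of_card_eq_finrank' (by simp)
end

section
/- For every real number c > 0, there exists a finite tree T on some number n of vertices such that the adjacency matrix of T has n distinct eigenvalues and ⌈n/2⌉ − rank(M̂(T)) > c. -/
open scoped Matrix Classical

namespace FarTree

/-- The graph joining every vertex to its parent. -/
def pgraph {V : Type} (p : V → V) : SimpleGraph V where
  Adj u v := u ≠ v ∧ (p u = v ∨ p v = u)
  symm := ⟨fun _ _ h => ⟨h.1.symm, h.2.symm⟩⟩
  loopless := ⟨fun _ h => h.1 rfl⟩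

/-- `u` is a (possibly zero) eigenvector for `t`. -/
def Eig {V : Type} [Fintype V] (p : V → V) (t : ℝ) (u : V → ℝ) : Prop :=
  ∀ i, ∑ j, (if (pgraph p).Adj i j then u j else 0) = t * u i

def p0 : Fin 18 → Fin 18 :=
  ![0, 0, 1, 2, 3, 1, 5, 1, 7, 0, 9, 10, 11, 0, 13, 14, 15, 0]

lemma base_eqs (t : ℝ) (u : Fin 18 → ℝ) (h : Eig p0 t u) :
    (u 1 + u 9 + u 13 + u 17 = t * u 0) ∧
    (u 0 + u 2 + u 5 + u 7 = t * u 1) ∧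
    (u 1 + u 3 = t * u 2) ∧
    (u 2 + u 4 = t * u 3) ∧
    (u 3 = t * u 4) ∧
    (u 1 + u 6 = t * u 5) ∧
    (u 5 = t * u 6) ∧
    (u 1 + u 8 = t * u 7) ∧
    (u 7 = t * u 8) ∧
    (u 0 + u 10 = t * u 9) ∧
    (u 9 + u 11 = t * u 10) ∧
    (u 10 + u 12 = t * u 11) ∧
    (u 11 = t * u 12) ∧
    (u 0 + u 14 = t * u 13) ∧
    (u 13 + u 15 = t * u 14) ∧
    (u 14 + u 16 = t * u 15) ∧
    (u 15 = t * u 16) ∧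
    (u 0 = t * u 17) := by
  refine ⟨?_, ?_, ?_, ?_, ?_, ?_, ?_, ?_, ?_, ?_, ?_, ?_, ?_, ?_, ?_, ?_, ?_, ?_⟩
  · simpa [Fin.sum_univ_succ, pgraph, p0, add_assoc] using h 0
  · simpa [Fin.sum_univ_succ, pgraph, p0, add_assoc] using h 1
  · simpa [Fin.sum_univ_succ, pgraph, p0, add_assoc] using h 2
  · simpa [Fin.sum_univ_succ, pgraph, p0, add_assoc] using h 3
  · simpa [Fin.sum_univ_succ, pgraph, p0, add_assoc] using h 4
  · simpa [Fin.sum_univ_succ, pgraph, p0, add_assoc] using h 5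
  · simpa [Fin.sum_univ_succ, pgraph, p0, add_assoc] using h 6
  · simpa [Fin.sum_univ_succ, pgraph, p0, add_assoc] using h 7
  · simpa [Fin.sum_univ_succ, pgraph, p0, add_assoc] using h 8
  · simpa [Fin.sum_univ_succ, pgraph, p0, add_assoc] using h 9
  · simpa [Fin.sum_univ_succ, pgraph, p0, add_assoc] using h 10
  · simpa [Fin.sum_univ_succ, pgraph, p0, add_assoc] using h 11
  · simpa [Fin.sum_univ_succ, pgraph, p0, add_assoc] using h 12
  · simpa [Fin.sum_univ_succ, pgraph, p0, add_assoc] using h 13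
  · simpa [Fin.sum_univ_succ, pgraph, p0, add_assoc] using h 14
  · simpa [Fin.sum_univ_succ, pgraph, p0, add_assoc] using h 15
  · simpa [Fin.sum_univ_succ, pgraph, p0, add_assoc] using h 16
  · simpa [Fin.sum_univ_succ, pgraph, p0, add_assoc] using h 17

lemma base_cyc (t : ℝ) (u : Fin 18 → ℝ) (h : Eig p0 t u) (hb : u 5 + u 12 = 0) : u = 0 := by
  obtain ⟨h0, h1, h2, h3, h4, h5, h6, h7, h8, h9, h10, h11, h12, h13, h14, h15, h16, h17⟩ := base_eqs t u h
  have g0 : u 5 + u 12 = 0 := hb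
  have g1 : u 1 + u 6 + u 11 = 0 := by
    linear_combination (1) * ((1) * h5 + (1) * h12 + t * g0)
  have g2 : u 0 + u 2 + u 7 + u 10 - u 12 = 0 := by
    linear_combination (1) * ((1) * h1 + (1) * h6 + (1) * h11 + t * g1) + (-2) * g0
  have g3 : u 3 - 3 * u 6 + u 8 + 2 * u 9 - 3 * u 11 + u 13 + u 17 = 0 := by
    linear_combination (1) * ((1) * h0 + (1) * h2 + (1) * h7 + (1) * h10 + (-1) * h12 + t * g2) + (-3) * g1
  have g4 : - 3 * u 2 + u 4 - 3 * u 7 - 5 * u 10 + 4 * u 12 + u 14 = 0 := by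
    linear_combination (1) * ((1) * h3 + (-3) * h6 + (1) * h8 + (2) * h9 + (-3) * h11 + (1) * h13 + (1) * h17 + t * g3) + (3) * g0 + (-4) * g2
  have g5 : - u 8 - u 9 - u 11 + 3 * u 13 + u 15 + 2 * u 17 = 0 := by
    linear_combination (1) * ((-3) * h2 + (1) * h4 + (-3) * h7 + (-5) * h10 + (4) * h12 + (1) * h14 + t * g4) + (6) * g1 + (2) * g3
  have g6 : - 4 * u 2 - 5 * u 7 - 6 * u 10 + 3 * u 12 + 4 * u 14 + u 16 = 0 := by
    linear_combination (1) * ((-1) * h8 + (-1) * h9 + (-1) * h11 + (3) * h13 + (1) * h15 + (2) * h17 + t * g5) + (-4) * g2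
  have g7 : - 3 * u 6 + 3 * u 9 - 5 * u 11 + 5 * u 13 + 4 * u 15 + 2 * u 17 = 0 := by
    linear_combination (1) * ((-4) * h2 + (-5) * h7 + (-6) * h10 + (3) * h12 + (4) * h14 + (1) * h16 + t * g6) + (9) * g1 + (4) * g3 + (-1) * g5
  have g8 : 6 * u 2 + 10 * u 7 + 12 * u 10 - 4 * u 12 - 7 * u 14 = 0 := by
    linear_combination (1) * ((-3) * h6 + (3) * h9 + (-5) * h11 + (5) * h13 + (4) * h15 + (2) * h17 + t * g7) + (3) * g0 + (-10) * g2 + (-4) * g6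
  have g9 : 5 * u 6 - 7 * u 9 + 11 * u 11 - 6 * u 13 - 7 * u 15 = 0 := by
    linear_combination (1) * ((6) * h2 + (10) * h7 + (12) * h10 + (-4) * h12 + (-7) * h14 + t * g8) + (-16) * g1 + (-6) * g3 + (4) * g5 + (-1) * g7
  have g10 : 12 * u 2 + 26 * u 7 + 34 * u 10 - 19 * u 14 = 0 := by
    linear_combination (2) * ((5) * h6 + (-7) * h9 + (11) * h11 + (-6) * h13 + (-7) * h15 + t * g9) + (-10) * g0 + (26) * g2 + (14) * g6 + (7) * g8
  have g11 : 14 * u 9 + 48 * u 11 - 13 * u 13 - 31 * u 15 = 0 := by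
    linear_combination (5) * ((12) * h2 + (26) * h7 + (34) * h10 + (-19) * h14 + t * g10) + (-190) * g1 + (-60) * g3 + (70) * g5 + (-40) * g7 + (-22) * g9
  have g12 : 10 * u 7 + 62 * u 10 - 35 * u 14 = 0 := by
    linear_combination (6/5) * ((14) * h9 + (48) * h11 + (-13) * h13 + (-31) * h15 + t * g11) + (-6/5) * g2 + (186/5) * g6 + (213/5) * g8 + (-44/5) * g10
  have g13 : 9 * u 9 - 36 * u 11 + 20 * u 15 = 0 := by
    linear_combination (13/24) * ((10) * h7 + (62) * h10 + (-35) * h14 + t * g12) + (-65/12) * g1 + (65/12) * g5 + (-65/12) * g7 + (-13/6) * g9 + (-31/24) * g11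
  have g14 : - 18 * u 10 + 5 * u 14 = 0 := by
    linear_combination (10/13) * ((9) * h9 + (-36) * h11 + (20) * h15 + t * g13) + (-90/13) * g2 + (-200/13) * g6 + (-435/26) * g8 + (595/156) * g10 + (-29/156) * g12
  have g15 : - 45 * u 11 + 19 * u 15 = 0 := by
    linear_combination (9/10) * ((-18) * h10 + (5) * h14 + t * g14) + (9/26) * g11 + (82/65) * g13
  have g16 : u 10 = 0 := by
    linear_combination (5/117) * ((-45) * h11 + (19) * h15 + t * g15) + (-95/117) * g6 + (-85/78) * g8 + (385/1404) * g10 + (-41/1404) * g12 + (-47/234) * g14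
  have g17 : - u 11 = 0 := by
    linear_combination (19/5) * ((1) * h10 + t * g16) + (-19/45) * g13 + (4/9) * g15
  funext i
  fin_cases i
  · show u 0 = 0
    linear_combination (1) * g2 + (-1/4) * g8 + (1/24) * g10 + (1/24) * g12 + (1/10) * g14 + (-1/5) * g16
  · show u 1 = 0
    linear_combination (1) * g1 + (-1/5) * g9 + (6/65) * g11 + (-35/117) * g13 + (67/171) * g15 + (-69/19) * g17
  · show u 2 = 0
    linear_combination (1/12) * g10 + (-13/60) * g12 + (-6/5) * g14 + (-11) * g16
  · show u 3 = 0
    linear_combination (1) * g3 + (1) * g5 + (-3/2) * g7 + (-3/10) * g9 + (-17/130) * g11 + (14/39) * g13 + (-25/57) * g15 + (14/19) * g17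
  · show u 4 = 0
    linear_combination (1) * g4 + (1) * g8 + (-1/4) * g10 + (-1/20) * g12 + (-1/10) * g14 + (14/5) * g16
  · show u 5 = 0
    linear_combination (1) * g0 + (1/4) * g8 + (-1/8) * g10 + (3/40) * g12 + (2/5) * g14 + (19/5) * g16
  · show u 6 = 0
    linear_combination (1/5) * g9 + (-6/65) * g11 + (35/117) * g13 + (-67/171) * g15 + (88/19) * g17
  · show u 7 = 0
    linear_combination (1/10) * g12 + (7/10) * g14 + (32/5) * g16
  · show u 8 = 0
    linear_combination (-1) * g5 + (1) * g7 + (3/5) * g9 + (-8/65) * g11 + (25/117) * g13 + (-62/171) * g15 + (101/19) * g17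
  · show u 9 = 0
    linear_combination (1/9) * g13 + (-20/171) * g15 + (24/19) * g17
  · show u 10 = 0
    linear_combination (1) * g16
  · show u 11 = 0
    linear_combination (-1) * g17
  · show u 12 = 0
    linear_combination (-1/4) * g8 + (1/8) * g10 + (-3/40) * g12 + (-2/5) * g14 + (-19/5) * g16
  · show u 13 = 0
    linear_combination (-1/13) * g11 + (14/117) * g13 + (-43/171) * g15 + (63/19) * g17
  · show u 14 = 0
    linear_combination (1/5) * g14 + (18/5) * g16
  · show u 15 = 0
    linear_combination (1/19) * g15 + (-45/19) * g17
  · show u 16 = 0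
    linear_combination (1) * g6 + (3/4) * g8 + (-1/24) * g10 + (-17/120) * g12 + (-9/10) * g14 + (-9) * g16
  · show u 17 = 0
    linear_combination (1/2) * g7 + (3/10) * g9 + (7/130) * g11 + (-2/117) * g13 + (1/9) * g15 + (-1) * g17

def x0 : Fin 10 → Fin 18 → ℝ :=
  ![![1, -1, 1, 0, -1, -1, 1, 0, 0, 0, 0, 0, 0, 0, 0, 0, 0, 0],
    ![0, 0, 0, 0, 0, -1, 0, 1, 0, 0, 0, 0, 0, 0, 0, 0, 0, 0],
    ![1, -1, 1, 0, -1, -1, 0, 0, 1, 0, 0, 0, 0, 0, 0, 0, 0, 0],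
    ![-1, 1, 0, 0, 0, 0, 0, 0, 0, 0, -1, 1, 0, 0, 0, 0, 0, 0],
    ![0, 0, 1, 0, -1, 0, 0, 0, 0, -1, 0, 0, 1, 0, 0, 0, 0, 0],
    ![0, 0, 0, 0, 0, 0, 0, 0, 0, -1, 0, 0, 0, 1, 0, 0, 0, 0],
    ![0, 0, 0, 0, 0, 0, 0, 0, 0, 0, -1, 0, 0, 0, 1, 0, 0, 0],
    ![-1, 1, 0, 0, 0, 0, 0, 0, 0, 0, -1, 0, 0, 0, 0, 1, 0, 0],
    ![0, 0, 1, 0, -1, 0, 0, 0, 0, -1, 0, 0, 0, 0, 0, 0, 1, 0],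
    ![-1, 1, -1, 1, -1, 0, 0, 0, 0, 0, 0, 0, 0, 0, 0, 0, 0, 1]]

lemma base_null0 (t : ℝ) (u : Fin 18 → ℝ) (h : Eig p0 t u) :
    u 0 ^ 2 - u 1 ^ 2 + u 2 ^ 2 - u 4 ^ 2 - u 5 ^ 2 + u 6 ^ 2 = 0 := by
  obtain ⟨h0, h1, h2, h3, h4, h5, h6, h7, h8, h9, h10, h11, h12, h13, h14, h15, h16, h17⟩ := base_eqs t u h
  linear_combination (1) * (h1 * u 0 - h0 * u 1) + (-1) * (h3 * u 0 - h0 * u 3) + (1) * (h3 * u 2 - h2 * u 3) +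
      (1) * (h4 * u 3 - h3 * u 4) + (1/2) * (h6 * u 0 - h0 * u 6) + (-1) * (h6 * u 5 - h5
      * u 6) + (-1/2) * (h7 * u 6 - h6 * u 7) + (1/2) * (h8 * u 0 - h0 * u 8) + (-1/2) *
      (h8 * u 5 - h5 * u 8) + (-1/2) * (h9 * u 5 - h5 * u 9) + (-1/2) * (h9 * u 7 - h7 * u
      9) + (-1) * (h10 * u 3 - h3 * u 10) + (-1) * (h11 * u 2 - h2 * u 11) + (-1) * (h11 *
      u 4 - h4 * u 11) + (1/2) * (h11 * u 5 - h5 * u 11) + (1/2) * (h11 * u 7 - h7 * u 11)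
      + (-1) * (h12 * u 3 - h3 * u 12) + (1/2) * (h12 * u 6 - h6 * u 12) + (1/2) * (h12 *
      u 8 - h8 * u 12) + (-1/2) * (h13 * u 5 - h5 * u 13) + (-1/2) * (h13 * u 7 - h7 * u
      13) + (-1) * (h14 * u 3 - h3 * u 14) + (-1) * (h15 * u 2 - h2 * u 15) + (-1) * (h15
      * u 4 - h4 * u 15) + (1/2) * (h15 * u 5 - h5 * u 15) + (1/2) * (h15 * u 7 - h7 * u
      15) + (-1) * (h16 * u 3 - h3 * u 16) + (1/2) * (h16 * u 6 - h6 * u 16) + (1/2) *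
      (h16 * u 8 - h8 * u 16) + (1) * (h17 * u 4 - h4 * u 17) + (-1/2) * (h17 * u 5 - h5 *
      u 17) + (-1/2) * (h17 * u 7 - h7 * u 17)

lemma base_null1 (t : ℝ) (u : Fin 18 → ℝ) (h : Eig p0 t u) :
    -u 5 ^ 2 + u 7 ^ 2 = 0 := by
  obtain ⟨h0, h1, h2, h3, h4, h5, h6, h7, h8, h9, h10, h11, h12, h13, h14, h15, h16, h17⟩ := base_eqs t u h
  linear_combination (1) * (h5 * u 1 - h1 * u 5) + (-1) * (h5 * u 3 - h3 * u 5) + (-1/2) * (h6 * u 0 - h0 * u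
      6) + (-1) * (h6 * u 4 - h4 * u 6) + (-1) * (h7 * u 1 - h1 * u 7) + (1) * (h7 * u 3 -
      h3 * u 7) + (-3/2) * (h7 * u 6 - h6 * u 7) + (1/2) * (h8 * u 0 - h0 * u 8) + (1) *
      (h8 * u 4 - h4 * u 8) + (-3/2) * (h8 * u 5 - h5 * u 8) + (1/2) * (h9 * u 5 - h5 * u
      9) + (-1/2) * (h9 * u 7 - h7 * u 9) + (-1/2) * (h11 * u 5 - h5 * u 11) + (1/2) *
      (h11 * u 7 - h7 * u 11) + (-1/2) * (h12 * u 6 - h6 * u 12) + (1/2) * (h12 * u 8 - h8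
      * u 12) + (1/2) * (h13 * u 5 - h5 * u 13) + (-1/2) * (h13 * u 7 - h7 * u 13) +
      (-1/2) * (h15 * u 5 - h5 * u 15) + (1/2) * (h15 * u 7 - h7 * u 15) + (-1/2) * (h16 *
      u 6 - h6 * u 16) + (1/2) * (h16 * u 8 - h8 * u 16) + (1/2) * (h17 * u 5 - h5 * u 17)
      + (-1/2) * (h17 * u 7 - h7 * u 17)

lemma base_null2 (t : ℝ) (u : Fin 18 → ℝ) (h : Eig p0 t u) :
    u 0 ^ 2 - u 1 ^ 2 + u 2 ^ 2 - u 4 ^ 2 - u 5 ^ 2 + u 8 ^ 2 = 0 := by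
  obtain ⟨h0, h1, h2, h3, h4, h5, h6, h7, h8, h9, h10, h11, h12, h13, h14, h15, h16, h17⟩ := base_eqs t u h
  linear_combination (1) * (h1 * u 0 - h0 * u 1) + (-1) * (h3 * u 0 - h0 * u 3) + (1) * (h3 * u 2 - h2 * u 3) +
      (1) * (h4 * u 3 - h3 * u 4) + (1) * (h5 * u 1 - h1 * u 5) + (-1) * (h5 * u 3 - h3 *
      u 5) + (-1) * (h6 * u 4 - h4 * u 6) + (-1) * (h7 * u 1 - h1 * u 7) + (1) * (h7 * u 3
      - h3 * u 7) + (-1) * (h7 * u 6 - h6 * u 7) + (1) * (h8 * u 0 - h0 * u 8) + (1) * (h8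
      * u 4 - h4 * u 8) + (-1) * (h8 * u 5 - h5 * u 8) + (-1) * (h8 * u 7 - h7 * u 8) +
      (-1) * (h9 * u 7 - h7 * u 9) + (-1) * (h10 * u 3 - h3 * u 10) + (-1) * (h11 * u 2 -
      h2 * u 11) + (-1) * (h11 * u 4 - h4 * u 11) + (1) * (h11 * u 7 - h7 * u 11) + (-1) *
      (h12 * u 3 - h3 * u 12) + (1) * (h12 * u 8 - h8 * u 12) + (-1) * (h13 * u 7 - h7 * u
      13) + (-1) * (h14 * u 3 - h3 * u 14) + (-1) * (h15 * u 2 - h2 * u 15) + (-1) * (h15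
      * u 4 - h4 * u 15) + (1) * (h15 * u 7 - h7 * u 15) + (-1) * (h16 * u 3 - h3 * u 16)
      + (1) * (h16 * u 8 - h8 * u 16) + (1) * (h17 * u 4 - h4 * u 17) + (-1) * (h17 * u 7
      - h7 * u 17)

lemma base_null3 (t : ℝ) (u : Fin 18 → ℝ) (h : Eig p0 t u) :
    -u 0 ^ 2 + u 1 ^ 2 - u 10 ^ 2 + u 11 ^ 2 = 0 := by
  obtain ⟨h0, h1, h2, h3, h4, h5, h6, h7, h8, h9, h10, h11, h12, h13, h14, h15, h16, h17⟩ := base_eqs t u h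
  linear_combination (-1) * (h1 * u 0 - h0 * u 1) + (1/2) * (h9 * u 4 - h4 * u 9) + (1/2) * (h9 * u 5 - h5 * u
      9) + (1/2) * (h9 * u 7 - h7 * u 9) + (1/2) * (h10 * u 3 - h3 * u 10) + (1/2) * (h10
      * u 6 - h6 * u 10) + (1/2) * (h10 * u 8 - h8 * u 10) + (1/2) * (h11 * u 2 - h2 * u
      11) + (-1) * (h11 * u 10 - h10 * u 11) + (1/2) * (h12 * u 1 - h1 * u 12) + (-1/2) *
      (h12 * u 6 - h6 * u 12) + (-1/2) * (h12 * u 8 - h8 * u 12) + (-1) * (h12 * u 9 - h9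
      * u 12) + (1/2) * (h13 * u 4 - h4 * u 13) + (1/2) * (h13 * u 5 - h5 * u 13) + (1/2)
      * (h13 * u 7 - h7 * u 13) + (-1/2) * (h13 * u 12 - h12 * u 13) + (1/2) * (h14 * u 3
      - h3 * u 14) + (1/2) * (h14 * u 6 - h6 * u 14) + (1/2) * (h14 * u 8 - h8 * u 14) +
      (-1/2) * (h14 * u 11 - h11 * u 14) + (1/2) * (h15 * u 2 - h2 * u 15) + (-1/2) * (h15
      * u 10 - h10 * u 15) + (1/2) * (h16 * u 1 - h1 * u 16) + (-1/2) * (h16 * u 6 - h6 *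
      u 16) + (-1/2) * (h16 * u 8 - h8 * u 16) + (-1/2) * (h16 * u 9 - h9 * u 16) + (1) *
      (h17 * u 2 - h2 * u 17) + (-1) * (h17 * u 4 - h4 * u 17)

lemma base_null4 (t : ℝ) (u : Fin 18 → ℝ) (h : Eig p0 t u) :
    u 2 ^ 2 - u 4 ^ 2 - u 9 ^ 2 + u 12 ^ 2 = 0 := by
  obtain ⟨h0, h1, h2, h3, h4, h5, h6, h7, h8, h9, h10, h11, h12, h13, h14, h15, h16, h17⟩ := base_eqs t u h
  linear_combination (-1) * (h3 * u 0 - h0 * u 3) + (1) * (h3 * u 2 - h2 * u 3) + (1) * (h4 * u 3 - h3 * u 4) +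
      (1/2) * (h9 * u 2 - h2 * u 9) + (1/2) * (h10 * u 1 - h1 * u 10) + (-1/2) * (h10 * u
      3 - h3 * u 10) + (-1) * (h10 * u 9 - h9 * u 10) + (-1/2) * (h11 * u 2 - h2 * u 11) +
      (-1/2) * (h11 * u 4 - h4 * u 11) + (1/2) * (h11 * u 5 - h5 * u 11) + (1/2) * (h11 *
      u 7 - h7 * u 11) + (-1) * (h11 * u 10 - h10 * u 11) + (-1/2) * (h12 * u 3 - h3 * u
      12) + (1/2) * (h12 * u 6 - h6 * u 12) + (1/2) * (h12 * u 8 - h8 * u 12) + (-1) *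
      (h12 * u 11 - h11 * u 12) + (1/2) * (h13 * u 2 - h2 * u 13) + (-1/2) * (h13 * u 10 -
      h10 * u 13) + (1/2) * (h14 * u 1 - h1 * u 14) + (-1/2) * (h14 * u 3 - h3 * u 14) +
      (-1/2) * (h14 * u 9 - h9 * u 14) + (-1/2) * (h14 * u 11 - h11 * u 14) + (-1/2) *
      (h15 * u 2 - h2 * u 15) + (-1/2) * (h15 * u 4 - h4 * u 15) + (1/2) * (h15 * u 5 - h5
      * u 15) + (1/2) * (h15 * u 7 - h7 * u 15) + (-1/2) * (h15 * u 10 - h10 * u 15) +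
      (-1/2) * (h15 * u 12 - h12 * u 15) + (-1/2) * (h16 * u 3 - h3 * u 16) + (1/2) * (h16
      * u 6 - h6 * u 16) + (1/2) * (h16 * u 8 - h8 * u 16) + (-1/2) * (h16 * u 11 - h11 *
      u 16) + (1) * (h17 * u 4 - h4 * u 17)

lemma base_null5 (t : ℝ) (u : Fin 18 → ℝ) (h : Eig p0 t u) :
    -u 9 ^ 2 + u 13 ^ 2 = 0 := by
  obtain ⟨h0, h1, h2, h3, h4, h5, h6, h7, h8, h9, h10, h11, h12, h13, h14, h15, h16, h17⟩ := base_eqs t u h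
  linear_combination (1) * (h9 * u 0 - h0 * u 9) + (-1/2) * (h9 * u 4 - h4 * u 9) + (-1/2) * (h9 * u 5 - h5 * u
      9) + (-1/2) * (h9 * u 7 - h7 * u 9) + (-1/2) * (h10 * u 3 - h3 * u 10) + (-1/2) *
      (h10 * u 6 - h6 * u 10) + (-1/2) * (h10 * u 8 - h8 * u 10) + (-1/2) * (h11 * u 2 -
      h2 * u 11) + (-1/2) * (h12 * u 1 - h1 * u 12) + (1/2) * (h12 * u 6 - h6 * u 12) +
      (1/2) * (h12 * u 8 - h8 * u 12) + (-1) * (h13 * u 0 - h0 * u 13) + (1/2) * (h13 * u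
      4 - h4 * u 13) + (1/2) * (h13 * u 5 - h5 * u 13) + (1/2) * (h13 * u 7 - h7 * u 13) +
      (-3/2) * (h13 * u 12 - h12 * u 13) + (1/2) * (h14 * u 3 - h3 * u 14) + (1/2) * (h14
      * u 6 - h6 * u 14) + (1/2) * (h14 * u 8 - h8 * u 14) + (-3/2) * (h14 * u 11 - h11 *
      u 14) + (1/2) * (h15 * u 2 - h2 * u 15) + (-3/2) * (h15 * u 10 - h10 * u 15) + (1/2)
      * (h16 * u 1 - h1 * u 16) + (-1/2) * (h16 * u 6 - h6 * u 16) + (-1/2) * (h16 * u 8 -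
      h8 * u 16) + (-3/2) * (h16 * u 9 - h9 * u 16) + (-1) * (h17 * u 10 - h10 * u 17) +
      (1) * (h17 * u 12 - h12 * u 17) + (1) * (h17 * u 14 - h14 * u 17) + (-1) * (h17 * u
      16 - h16 * u 17)

lemma base_null6 (t : ℝ) (u : Fin 18 → ℝ) (h : Eig p0 t u) :
    -u 10 ^ 2 + u 14 ^ 2 = 0 := by
  obtain ⟨h0, h1, h2, h3, h4, h5, h6, h7, h8, h9, h10, h11, h12, h13, h14, h15, h16, h17⟩ := base_eqs t u h
  linear_combination (1) * (h9 * u 0 - h0 * u 9) + (-1/2) * (h9 * u 2 - h2 * u 9) + (-1/2) * (h9 * u 4 - h4 * u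
      9) + (-1/2) * (h9 * u 5 - h5 * u 9) + (-1/2) * (h9 * u 7 - h7 * u 9) + (-1/2) * (h10
      * u 1 - h1 * u 10) + (-1) * (h10 * u 3 - h3 * u 10) + (-1/2) * (h10 * u 6 - h6 * u
      10) + (-1/2) * (h10 * u 8 - h8 * u 10) + (1) * (h10 * u 9 - h9 * u 10) + (1) * (h11
      * u 0 - h0 * u 11) + (-1) * (h11 * u 2 - h2 * u 11) + (-1/2) * (h11 * u 4 - h4 * u
      11) + (-1/2) * (h11 * u 5 - h5 * u 11) + (-1/2) * (h11 * u 7 - h7 * u 11) + (-1/2) *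
      (h12 * u 1 - h1 * u 12) + (-1/2) * (h12 * u 3 - h3 * u 12) + (-1) * (h13 * u 0 - h0
      * u 13) + (1/2) * (h13 * u 2 - h2 * u 13) + (1/2) * (h13 * u 4 - h4 * u 13) + (1/2)
      * (h13 * u 5 - h5 * u 13) + (1/2) * (h13 * u 7 - h7 * u 13) + (-1/2) * (h13 * u 10 -
      h10 * u 13) + (-3/2) * (h13 * u 12 - h12 * u 13) + (1/2) * (h14 * u 1 - h1 * u 14) +
      (1) * (h14 * u 3 - h3 * u 14) + (1/2) * (h14 * u 6 - h6 * u 14) + (1/2) * (h14 * u 8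
      - h8 * u 14) + (-1/2) * (h14 * u 9 - h9 * u 14) + (-1) * (h14 * u 11 - h11 * u 14) +
      (-1) * (h14 * u 13 - h13 * u 14) + (-1) * (h15 * u 0 - h0 * u 15) + (1) * (h15 * u 2
      - h2 * u 15) + (1/2) * (h15 * u 4 - h4 * u 15) + (1/2) * (h15 * u 5 - h5 * u 15) +
      (1/2) * (h15 * u 7 - h7 * u 15) + (-1) * (h15 * u 10 - h10 * u 15) + (1/2) * (h15 *
      u 12 - h12 * u 15) + (1/2) * (h16 * u 1 - h1 * u 16) + (1/2) * (h16 * u 3 - h3 * u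
      16) + (-3/2) * (h16 * u 9 - h9 * u 16) + (1/2) * (h16 * u 11 - h11 * u 16) + (-1) *
      (h17 * u 10 - h10 * u 17) + (1) * (h17 * u 14 - h14 * u 17)

lemma base_null7 (t : ℝ) (u : Fin 18 → ℝ) (h : Eig p0 t u) :
    -u 0 ^ 2 + u 1 ^ 2 - u 10 ^ 2 + u 15 ^ 2 = 0 := by
  obtain ⟨h0, h1, h2, h3, h4, h5, h6, h7, h8, h9, h10, h11, h12, h13, h14, h15, h16, h17⟩ := base_eqs t u h
  linear_combination (-1) * (h1 * u 0 - h0 * u 1) + (1) * (h9 * u 0 - h0 * u 9) + (-1/2) * (h9 * u 2 - h2 * u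
      9) + (-1/2) * (h10 * u 1 - h1 * u 10) + (-1/2) * (h10 * u 3 - h3 * u 10) + (1) *
      (h10 * u 9 - h9 * u 10) + (1) * (h11 * u 0 - h0 * u 11) + (-1/2) * (h11 * u 2 - h2 *
      u 11) + (-1/2) * (h11 * u 4 - h4 * u 11) + (-1/2) * (h11 * u 5 - h5 * u 11) + (-1/2)
      * (h11 * u 7 - h7 * u 11) + (-1/2) * (h12 * u 3 - h3 * u 12) + (-1/2) * (h12 * u 6 -
      h6 * u 12) + (-1/2) * (h12 * u 8 - h8 * u 12) + (-1) * (h13 * u 0 - h0 * u 13) +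
      (1/2) * (h13 * u 2 - h2 * u 13) + (1) * (h13 * u 4 - h4 * u 13) + (1) * (h13 * u 5 -
      h5 * u 13) + (1) * (h13 * u 7 - h7 * u 13) + (-1/2) * (h13 * u 10 - h10 * u 13) +
      (-1) * (h13 * u 12 - h12 * u 13) + (1/2) * (h14 * u 1 - h1 * u 14) + (3/2) * (h14 *
      u 3 - h3 * u 14) + (1) * (h14 * u 6 - h6 * u 14) + (1) * (h14 * u 8 - h8 * u 14) +
      (-1/2) * (h14 * u 9 - h9 * u 14) + (-1/2) * (h14 * u 11 - h11 * u 14) + (-1) * (h14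
      * u 13 - h13 * u 14) + (-1) * (h15 * u 0 - h0 * u 15) + (3/2) * (h15 * u 2 - h2 * u
      15) + (1/2) * (h15 * u 4 - h4 * u 15) + (1/2) * (h15 * u 5 - h5 * u 15) + (1/2) *
      (h15 * u 7 - h7 * u 15) + (-1/2) * (h15 * u 10 - h10 * u 15) + (1/2) * (h15 * u 12 -
      h12 * u 15) + (-1) * (h15 * u 14 - h14 * u 15) + (1) * (h16 * u 1 - h1 * u 16) +
      (1/2) * (h16 * u 3 - h3 * u 16) + (-1/2) * (h16 * u 6 - h6 * u 16) + (-1/2) * (h16 *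
      u 8 - h8 * u 16) + (-1) * (h16 * u 9 - h9 * u 16) + (1/2) * (h16 * u 11 - h11 * u
      16) + (-1) * (h16 * u 13 - h13 * u 16) + (1) * (h17 * u 2 - h2 * u 17) + (-1) * (h17
      * u 4 - h4 * u 17) + (-1) * (h17 * u 10 - h10 * u 17) + (1) * (h17 * u 14 - h14 * u
      17)

lemma base_null8 (t : ℝ) (u : Fin 18 → ℝ) (h : Eig p0 t u) :
    u 2 ^ 2 - u 4 ^ 2 - u 9 ^ 2 + u 16 ^ 2 = 0 := by
  obtain ⟨h0, h1, h2, h3, h4, h5, h6, h7, h8, h9, h10, h11, h12, h13, h14, h15, h16, h17⟩ := base_eqs t u h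
  linear_combination (-1) * (h3 * u 0 - h0 * u 3) + (1) * (h3 * u 2 - h2 * u 3) + (1) * (h4 * u 3 - h3 * u 4) +
      (1) * (h9 * u 0 - h0 * u 9) + (1/2) * (h9 * u 2 - h2 * u 9) + (-1/2) * (h9 * u 4 -
      h4 * u 9) + (-1/2) * (h9 * u 5 - h5 * u 9) + (-1/2) * (h9 * u 7 - h7 * u 9) + (1/2)
      * (h10 * u 1 - h1 * u 10) + (-1) * (h10 * u 3 - h3 * u 10) + (-1/2) * (h10 * u 6 -
      h6 * u 10) + (-1/2) * (h10 * u 8 - h8 * u 10) + (-1) * (h11 * u 2 - h2 * u 11) +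
      (-1/2) * (h11 * u 4 - h4 * u 11) + (1/2) * (h11 * u 5 - h5 * u 11) + (1/2) * (h11 *
      u 7 - h7 * u 11) + (-1/2) * (h12 * u 1 - h1 * u 12) + (-1/2) * (h12 * u 3 - h3 * u
      12) + (1) * (h12 * u 6 - h6 * u 12) + (1) * (h12 * u 8 - h8 * u 12) + (-1) * (h13 *
      u 0 - h0 * u 13) + (1/2) * (h13 * u 2 - h2 * u 13) + (1/2) * (h13 * u 4 - h4 * u 13)
      + (1/2) * (h13 * u 5 - h5 * u 13) + (1/2) * (h13 * u 7 - h7 * u 13) + (1/2) * (h13 *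
      u 10 - h10 * u 13) + (-3/2) * (h13 * u 12 - h12 * u 13) + (1/2) * (h14 * u 1 - h1 *
      u 14) + (1/2) * (h14 * u 6 - h6 * u 14) + (1/2) * (h14 * u 8 - h8 * u 14) + (1/2) *
      (h14 * u 9 - h9 * u 14) + (-1) * (h14 * u 11 - h11 * u 14) + (-1) * (h14 * u 13 -
      h13 * u 14) + (-1/2) * (h15 * u 4 - h4 * u 15) + (1/2) * (h15 * u 5 - h5 * u 15) +
      (1/2) * (h15 * u 7 - h7 * u 15) + (-1) * (h15 * u 10 - h10 * u 15) + (1/2) * (h15 *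
      u 12 - h12 * u 15) + (-1) * (h15 * u 14 - h14 * u 15) + (1/2) * (h16 * u 1 - h1 * u
      16) + (-1/2) * (h16 * u 3 - h3 * u 16) + (-3/2) * (h16 * u 9 - h9 * u 16) + (1/2) *
      (h16 * u 11 - h11 * u 16) + (-1) * (h16 * u 15 - h15 * u 16) + (1) * (h17 * u 4 - h4
      * u 17) + (-1) * (h17 * u 10 - h10 * u 17) + (1) * (h17 * u 12 - h12 * u 17) + (1) *
      (h17 * u 14 - h14 * u 17) + (-1) * (h17 * u 16 - h16 * u 17)

lemma base_null9 (t : ℝ) (u : Fin 18 → ℝ) (h : Eig p0 t u) :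
    -u 0 ^ 2 + u 1 ^ 2 - u 2 ^ 2 + u 3 ^ 2 - u 4 ^ 2 + u 17 ^ 2 = 0 := by
  obtain ⟨h0, h1, h2, h3, h4, h5, h6, h7, h8, h9, h10, h11, h12, h13, h14, h15, h16, h17⟩ := base_eqs t u h
  linear_combination (1) * (h2 * u 1 - h1 * u 2) + (-1) * (h4 * u 1 - h1 * u 4) + (1) * (h4 * u 3 - h3 * u 4) +
      (-1) * (h6 * u 0 - h0 * u 6) + (1) * (h6 * u 2 - h2 * u 6) + (-1) * (h6 * u 4 - h4 *
      u 6) + (-1) * (h8 * u 0 - h0 * u 8) + (1) * (h8 * u 2 - h2 * u 8) + (-1) * (h8 * u 4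
      - h4 * u 8) + (1) * (h9 * u 2 - h2 * u 9) + (-1) * (h9 * u 4 - h4 * u 9) + (1) *
      (h10 * u 1 - h1 * u 10) + (-1) * (h10 * u 6 - h6 * u 10) + (-1) * (h10 * u 8 - h8 *
      u 10) + (1) * (h11 * u 4 - h4 * u 11) + (-1) * (h12 * u 1 - h1 * u 12) + (1) * (h12
      * u 3 - h3 * u 12) + (1) * (h12 * u 6 - h6 * u 12) + (1) * (h12 * u 8 - h8 * u 12) +
      (1) * (h13 * u 2 - h2 * u 13) + (-1) * (h13 * u 4 - h4 * u 13) + (1) * (h14 * u 1 -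
      h1 * u 14) + (-1) * (h14 * u 6 - h6 * u 14) + (-1) * (h14 * u 8 - h8 * u 14) + (1) *
      (h15 * u 4 - h4 * u 15) + (-1) * (h16 * u 1 - h1 * u 16) + (1) * (h16 * u 3 - h3 * u
      16) + (1) * (h16 * u 6 - h6 * u 16) + (1) * (h16 * u 8 - h8 * u 16) + (-1) * (h17 *
      u 0 - h0 * u 17) + (-1) * (h17 * u 2 - h2 * u 17) + (1) * (h17 * u 4 - h4 * u 17) +
      (1) * (h17 * u 5 - h5 * u 17) + (1) * (h17 * u 7 - h7 * u 17) + (1) * (h17 * u 10 -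
      h10 * u 17) + (-1) * (h17 * u 12 - h12 * u 17) + (1) * (h17 * u 14 - h14 * u 17) +
      (-1) * (h17 * u 16 - h16 * u 17)

lemma base_null (t : ℝ) (u : Fin 18 → ℝ) (h : Eig p0 t u) (k : Fin 10) :
    ∑ i, x0 k i * u i ^ 2 = 0 := by
  fin_cases k
  · have := base_null0 t u h
    simp [Fin.sum_univ_succ, x0]
    linarith
  · have := base_null1 t u h
    simp [Fin.sum_univ_succ, x0]
    linarith
  · have := base_null2 t u h
    simp [Fin.sum_univ_succ, x0]
    linarith
  · have := base_null3 t u h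
    simp [Fin.sum_univ_succ, x0]
    linarith
  · have := base_null4 t u h
    simp [Fin.sum_univ_succ, x0]
    linarith
  · have := base_null5 t u h
    simp [Fin.sum_univ_succ, x0]
    linarith
  · have := base_null6 t u h
    simp [Fin.sum_univ_succ, x0]
    linarith
  · have := base_null7 t u h
    simp [Fin.sum_univ_succ, x0]
    linarith
  · have := base_null8 t u h
    simp [Fin.sum_univ_succ, x0]
    linarith
  · have := base_null9 t u h
    simp [Fin.sum_univ_succ, x0]
    linarith

structure Good (V ι : Type) [Fintype V] [Fintype ι] (p : V → V) : Prop where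
  tree : ∃ (r : V) (d : V → ℕ), p r = r ∧ ∀ u, u ≠ r → d (p u) < d u
  cyc : ∃ b : V → ℝ, ∀ t u, Eig p t u → ∑ i, b i * u i = 0 → u = 0
  null : ∃ x : ι → V → ℝ, LinearIndependent ℝ x ∧
    ∀ t u, Eig p t u → ∀ k, ∑ i, x k i * u i ^ 2 = 0

/-- Attach a pendant vertex everywhere. -/
def dbl {V : Type} (p : V → V) : V ⊕ V → V ⊕ V :=
  Sum.elim (fun u => Sum.inl (p u)) (fun u => Sum.inl u)

lemma dbl_eig {V : Type} [Fintype V] (p : V → V) (t : ℝ) (w : V ⊕ V → ℝ)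
    (h : Eig (dbl p) t w) :
    Eig p (t - t⁻¹) (fun i => w (Sum.inl i)) ∧ ∀ i, w (Sum.inr i) = t⁻¹ * w (Sum.inl i) := by
  have h1 : ∀ i, (∑ j, (if (pgraph p).Adj i j then w (Sum.inl j) else 0)) + w (Sum.inr i)
      = t * w (Sum.inl i) := by
    intro i
    have := h (Sum.inl i)
    simp [Fintype.sum_sum_type, pgraph, dbl] at this ⊢
    convert this using 3
    all_goals congr
  have h2 : ∀ i, w (Sum.inl i) = t * w (Sum.inr i) := by
    intro i
    have := h (Sum.inr i)
    simpa [Fintype.sum_sum_type, pgraph, dbl] using this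
  by_cases ht : t = 0
  · subst ht
    have hl : ∀ i, w (Sum.inl i) = 0 := fun i => by simpa using h2 i
    have hr : ∀ i, w (Sum.inr i) = 0 := fun i => by simpa [hl] using h1 i
    refine ⟨fun i => by simp [hl], fun i => by simp [hl, hr]⟩
  · have h3 : ∀ i, w (Sum.inr i) = t⁻¹ * w (Sum.inl i) := fun i => by
      rw [h2 i]; field_simp
    refine ⟨fun i => ?_, h3⟩
    have := h1 i
    rw [h3 i] at this
    linear_combination this

lemma Good.dbl {V ι : Type} [Fintype V] [Fintype ι] {p : V → V} (g : Good V ι p) :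
    Good (V ⊕ V) (ι ⊕ ι) (FarTree.dbl p) := by
  refine ⟨?_, ?_, ?_⟩
  · obtain ⟨r, d, hr, hd⟩ := g.tree
    refine ⟨Sum.inl r, Sum.elim d (fun u => d u + 1), by simp [FarTree.dbl, hr], ?_⟩
    rintro (u | u) hu
    · simpa [FarTree.dbl] using hd u (fun h => hu (by rw [h]))
    · simp [FarTree.dbl]
  · obtain ⟨b, hb⟩ := g.cyc
    refine ⟨Sum.elim b 0, fun t u h hs => ?_⟩
    obtain ⟨h1, h2⟩ := dbl_eig p t u h
    have h3 := hb _ _ h1 (by simpa [Fintype.sum_sum_type] using hs)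
    funext i
    rcases i with i | i
    · exact congrFun h3 i
    · have := congrFun h3 i
      simp only [Pi.zero_apply] at this
      rw [h2 i, this]; simp
  · obtain ⟨x, hx, hn⟩ := g.null
    refine ⟨Sum.elim (fun k => Sum.elim (x k) 0) (fun k => Sum.elim 0 (x k)), ?_, ?_⟩
    · rw [Fintype.linearIndependent_iff] at hx ⊢
      intro c hc
      have e1 := hx (fun k => c (Sum.inl k)) (by
        funext i
        have := congrFun hc (Sum.inl i)
        simpa [Fintype.sum_sum_type, Finset.sum_apply] using this)
      have e2 := hx (fun k => c (Sum.inr k)) (by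
        funext i
        have := congrFun hc (Sum.inr i)
        simpa [Fintype.sum_sum_type, Finset.sum_apply] using this)
      rintro (k | k)
      · exact e1 k
      · exact e2 k
    · intro t u h
      obtain ⟨h1, h2⟩ := dbl_eig p t u h
      have h3 := hn _ _ h1
      rintro (k | k)
      · simpa [Fintype.sum_sum_type] using h3 k
      · have : ∀ i, x k i * u (Sum.inr i) ^ 2 = t⁻¹ ^ 2 * (x k i * u (Sum.inl i) ^ 2) := by
          intro i; rw [h2 i]; ring
        simp only [Fintype.sum_sum_type, Sum.elim_inr, Sum.elim_inl, Pi.zero_apply, zero_mul,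
          Finset.sum_const_zero, zero_add, this]
        rw [← Finset.mul_sum, h3 k, mul_zero]

lemma Good.transport {V W ι : Type} [Fintype V] [Fintype W] [Fintype ι] {p : V → V}
    (g : Good V ι p) (e : V ≃ W) : Good W ι (fun w => e (p (e.symm w))) := by
  have key : ∀ t (u : W → ℝ), Eig (fun w => e (p (e.symm w))) t u → Eig p t (fun i => u (e i)) := by
    intro t u h i
    have := h (e i)
    rw [← Equiv.sum_comp e] at this
    simp [pgraph] at this ⊢
    convert this using 3
    all_goals congr
  refine ⟨?_, ?_, ?_⟩
  · obtain ⟨r, d, hr, hd⟩ := g.tree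
    refine ⟨e r, fun w => d (e.symm w), by simp [hr], fun u hu => ?_⟩
    simpa using hd (e.symm u) (fun h => hu (by rw [← h]; simp))
  · obtain ⟨b, hb⟩ := g.cyc
    refine ⟨fun w => b (e.symm w), fun t u h hs => ?_⟩
    have := hb _ _ (key t u h) (by
      rw [← Equiv.sum_comp e] at hs
      simpa using hs)
    funext w
    simpa using congrFun this (e.symm w)
  · obtain ⟨x, hx, hn⟩ := g.null
    refine ⟨fun k w => x k (e.symm w), ?_, fun t u h k => ?_⟩
    · rw [Fintype.linearIndependent_iff] at hx ⊢
      intro c hc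
      refine hx c ?_
      funext i
      have := congrFun hc (e i)
      simpa [Finset.sum_apply] using this
    · rw [← Equiv.sum_comp e]
      simpa using hn _ _ (key t u h) k

lemma tree_of_parent {V : Type} [Fintype V] (p : V → V) (r : V) (d : V → ℕ) (hr : p r = r)
    (hd : ∀ u, u ≠ r → d (p u) < d u) : (pgraph p).IsTree := by
  have hreach : ∀ k u, d u = k → (pgraph p).Reachable u r := by
    intro k
    induction k using Nat.strong_induction_on with
    | _ k ih =>
      intro u hu
      by_cases h : u = r
      · subst h; exact SimpleGraph.Reachable.refl _
      · have h1 := hd u h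
        have hadj : (pgraph p).Adj u (p u) :=
          ⟨fun h2 => by rw [← h2] at h1; exact lt_irrefl _ h1, Or.inl rfl⟩
        exact hadj.reachable.trans (ih _ (hu ▸ h1) _ rfl)
  have hconn : (pgraph p).Connected := by
    have : Nonempty V := ⟨r⟩
    exact ⟨fun u v => (hreach _ u rfl).trans (hreach _ v rfl).symm⟩
  rw [SimpleGraph.isTree_iff_connected_and_card]
  refine ⟨hconn, le_antisymm ?_ hconn.card_vert_le_card_edgeSet_add_one⟩
  have hsub : (pgraph p).edgeSet ⊆ (fun u => s(u, p u)) '' {u | u ≠ r} := by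
    intro e
    induction e using Sym2.ind with
    | _ a b =>
      intro h
      rw [SimpleGraph.mem_edgeSet] at h
      obtain ⟨hne, h | h⟩ := h
      · refine ⟨a, fun ha => hne ?_, by simp [h]⟩
        rw [← h, ha, hr]
      · refine ⟨b, fun hb => hne ?_, by simp [h, Sym2.eq_swap]⟩
        rw [← h, hb, hr]
  have h1 : Nat.card (pgraph p).edgeSet ≤ Nat.card {u : V | u ≠ r} := by
    rw [Nat.card_coe_set_eq, Nat.card_coe_set_eq]
    exact (Set.ncard_le_ncard hsub (Set.toFinite _)).trans (Set.ncard_image_le (Set.toFinite _))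
  have h2 : Nat.card {u : V | u ≠ r} + 1 = Nat.card V := by
    rw [Nat.card_coe_set_eq]
    have := Set.ncard_add_ncard_compl ({r} : Set V)
    rw [Set.ncard_singleton] at this
    rw [← this, add_comm]
    rfl
  omega

lemma base_good : Good (Fin 18) (Fin 10) p0 := by
  refine ⟨⟨0, ![0, 1, 2, 3, 4, 2, 3, 2, 3, 1, 2, 3, 4, 1, 2, 3, 4, 1], by decide, by decide⟩,
    ⟨fun i => if i = 5 ∨ i = 12 then 1 else 0, fun t u h hs => base_cyc t u h ?_⟩,
    ⟨x0, ?_, fun t u h k => base_null t u h k⟩⟩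
  · simpa [Fin.sum_univ_succ] using hs
  · rw [Fintype.linearIndependent_iff]
    intro c hc i
    have h := fun j => congrFun hc j
    have f0 := h 6
    have f1 := h 7
    have f2 := h 8
    have f3 := h 11
    have f4 := h 12
    have f5 := h 13
    have f6 := h 14
    have f7 := h 15
    have f8 := h 16
    have f9 := h 17
    simp [Fin.sum_univ_succ, x0] at f0 f1 f2 f3 f4 f5 f6 f7 f8 f9
    fin_cases i <;> assumption

lemma good_iter (k : ℕ) : ∃ (V ι : Type) (_ : Fintype V) (_ : Fintype ι) (p : V → V),
    Good V ι p ∧ Even (Fintype.card V) ∧ 2 * Fintype.card ι ≥ Fintype.card V + 2 ^ (k + 1) := by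
  induction k with
  | zero => exact ⟨_, _, _, _, p0, base_good, by simp; decide, by simp⟩
  | succ k ih =>
    obtain ⟨V, ι, _, _, p, g, he, h⟩ := ih
    refine ⟨_, _, _, _, _, g.dbl, by simp, ?_⟩
    simp only [Fintype.card_sum]
    have : 2 ^ (k + 1 + 1) = 2 ^ (k + 1) + 2 ^ (k + 1) := by ring
    omega

lemma eig_iff {V : Type} [Fintype V] (p : V → V) (t : ℝ) (u : V → ℝ) :
    Eig p t u ↔ (pgraph p).adjMatrix ℝ *ᵥ u = t • u := by
  rw [funext_iff]
  simp [Eig, Matrix.mulVec, dotProduct, SimpleGraph.adjMatrix_apply]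

lemma final {n : ℕ} {ι : Type} [Fintype ι] (p : Fin n → Fin n) (g : Good (Fin n) ι p) :
    (pgraph p).IsTree ∧
      ∃ (θ : Fin n → ℝ) (E : Fin n → Matrix (Fin n) (Fin n) ℝ),
        Function.Injective θ ∧
        (∀ r, (E r).IsSymm) ∧
        (∀ r s, E r * E s = if r = s then E r else 0) ∧
        (∀ r, E r ≠ 0) ∧
        (∑ r, E r = 1) ∧
        ((pgraph p).adjMatrix ℝ = ∑ r, θ r • E r) ∧
        (∑ r, E r ⊙ E r).rank + Fintype.card ι ≤ n := by
  obtain ⟨r, d, hr, hd⟩ := g.tree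
  refine ⟨tree_of_parent p r d hr hd, ?_⟩
  obtain ⟨b, hb⟩ := g.cyc
  obtain ⟨x, hx, hn⟩ := g.null
  have hA : ((pgraph p).adjMatrix ℝ).IsHermitian := by
    have := SimpleGraph.isSymm_adjMatrix (α := ℝ) (pgraph p)
    rw [Matrix.IsHermitian, Matrix.conjTranspose_eq_transpose_of_trivial]
    exact this
  set A := (pgraph p).adjMatrix ℝ with hAdef
  let v : Fin n → Fin n → ℝ := fun r => (hA.eigenvectorBasis r).ofLp
  have hv : ∀ r, A *ᵥ v r = hA.eigenvalues r • v r := fun r => hA.mulVec_eigenvectorBasis r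
  have hveig : ∀ r, Eig p (hA.eigenvalues r) (v r) := fun r => (eig_iff _ _ _).2 (hv r)
  have horth : ∀ r s, v r ⬝ᵥ v s = if r = s then 1 else 0 := by
    intro r s
    have := (orthonormal_iff_ite.1 hA.eigenvectorBasis.orthonormal) s r
    simp only [EuclideanSpace.inner_eq_star_dotProduct] at this
    simpa [v, eq_comm] using this
  have hsum : ∑ r, Matrix.vecMulVec (v r) (v r) = 1 := by
    let Q : Matrix (Fin n) (Fin n) ℝ := Matrix.of v
    have hQ : Q * Qᵀ = 1 := by
      ext r s
      rw [Matrix.one_apply, ← horth r s]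
      rfl
    have hQ' := mul_eq_one_comm.1 hQ
    rw [← hQ']
    ext i j
    simp [Matrix.sum_apply, Matrix.vecMulVec_apply, Matrix.mul_apply, Q]
  refine ⟨hA.eigenvalues, fun r => Matrix.vecMulVec (v r) (v r), ?_, ?_, ?_, ?_, hsum, ?_, ?_⟩
  · intro r s hrs
    by_contra hne
    have h1 : A *ᵥ ((b ⬝ᵥ v s) • v r - (b ⬝ᵥ v r) • v s)
        = hA.eigenvalues r • ((b ⬝ᵥ v s) • v r - (b ⬝ᵥ v r) • v s) := by
      rw [Matrix.mulVec_sub, Matrix.mulVec_smul, Matrix.mulVec_smul, hv, hv, ← hrs, smul_sub,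
        smul_comm, smul_comm (b ⬝ᵥ v r)]
    have h2 := hb _ _ ((eig_iff _ _ _).2 h1) (by
      change b ⬝ᵥ _ = 0
      rw [dotProduct_sub, dotProduct_smul, dotProduct_smul]
      simp only [smul_eq_mul]
      ring)
    have h3 : b ⬝ᵥ v s = 0 := by
      have := congrArg (fun w => v r ⬝ᵥ w) h2
      simpa [dotProduct_sub, horth, hne] using this
    have h4 := hb _ _ (hveig s) h3
    have := horth s s
    simp [h4] at this
  · intro r
    ext i j
    simp [Matrix.transpose_apply, Matrix.vecMulVec_apply, mul_comm]
  · intro r s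
    rw [Matrix.vecMulVec_mul_vecMulVec, horth]
    split_ifs with h
    · subst h; simp
    · simp
  · intro r h0
    have h1 := congrArg (fun M => M *ᵥ v r) h0
    simp only [Matrix.vecMulVec_mulVec, horth, Matrix.zero_mulVec] at h1
    have := horth r r
    simp at h1
    simp [h1] at this
  · refine (mul_one A).symm.trans ?_
    rw [← hsum, Finset.mul_sum]
    refine Finset.sum_congr rfl fun r _ => ?_
    rw [Matrix.mul_vecMulVec, hv, Matrix.smul_vecMulVec]
  · set M := ∑ r, Matrix.vecMulVec (v r) (v r) ⊙ Matrix.vecMulVec (v r) (v r) with hM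
    have hker : ∀ k, M *ᵥ x k = 0 := by
      intro k
      rw [hM, Matrix.sum_mulVec]
      refine Finset.sum_eq_zero fun r _ => ?_
      funext i
      have h := hn _ _ (hveig r) k
      simp only [Matrix.mulVec, dotProduct, Matrix.hadamard_apply, Matrix.vecMulVec_apply,
        Pi.zero_apply]
      calc ∑ j, v r i * v r j * (v r i * v r j) * x k j
          = v r i ^ 2 * ∑ j, x k j * v r j ^ 2 := by
            rw [Finset.mul_sum]
            exact Finset.sum_congr rfl fun j _ => by ring
        _ = 0 := by rw [h, mul_zero]
    have h1 := LinearMap.finrank_range_add_finrank_ker M.mulVecLin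
    have h2 : Fintype.card ι ≤ Module.finrank ℝ (LinearMap.ker M.mulVecLin) := by
      let y : ι → LinearMap.ker M.mulVecLin := fun k => ⟨x k, by simpa using hker k⟩
      have hy : LinearIndependent ℝ y :=
        LinearIndependent.of_comp (LinearMap.ker M.mulVecLin).subtype (by exact hx)
      exact hy.fintype_card_le_finrank
    simp only [Module.finrank_fin_fun] at h1
    change M.rank + _ ≤ n
    rw [Matrix.rank]
    omega

end FarTree

/-- For every `c > 0` there is a tree `T` on `n` vertices with `n` distinct
eigenvalues such that `⌈n/2⌉ − rank M̂(T) > c`. -/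
theorem exists_tree_rank_avgMixing_far_from_half : ∀ c : ℝ, 0 < c →
    ∃ (n : ℕ) (T : SimpleGraph (Fin n)), T.IsTree ∧
      ∃ (θ : Fin n → ℝ) (E : Fin n → Matrix (Fin n) (Fin n) ℝ),
        Function.Injective θ ∧
        (∀ r, (E r).IsSymm) ∧
        (∀ r s, E r * E s = if r = s then E r else 0) ∧
        (∀ r, E r ≠ 0) ∧
        (∑ r, E r = 1) ∧
        (T.adjMatrix ℝ = ∑ r, θ r • E r) ∧
        ((⌈(n : ℝ) / 2⌉ : ℤ) : ℝ) - ((∑ r, E r ⊙ E r).rank : ℝ) > c := by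
  intro c _
  obtain ⟨k, hk⟩ := pow_unbounded_of_one_lt c (by norm_num : (1 : ℝ) < 2)
  obtain ⟨V, ι, _, _, p, g, he, h⟩ := FarTree.good_iter k
  obtain ⟨htree, θ, E, h1, h2, h3, h4, h5, h6, h7⟩ :=
    FarTree.final _ (g.transport (Fintype.equivFin V))
  refine ⟨_, _, htree, θ, E, h1, h2, h3, h4, h5, h6, ?_⟩
  have hc := Int.le_ceil ((Fintype.card V : ℝ) / 2)
  have h7' : ((∑ r, E r ⊙ E r).rank : ℝ) + Fintype.card ι ≤ Fintype.card V := by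
    exact_mod_cast h7
  have h' : (Fintype.card V : ℝ) + 2 ^ (k + 1) ≤ 2 * Fintype.card ι := by exact_mod_cast h
  rw [pow_succ] at h'
  linarith
end
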